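/- Let p be prime and n ≥ pk. Then the chromatic number of the almost 2-stable Kneser hypergraph KG^p([n] choose k)~_{2-stab} equals ⌈(n-(k-1)p)/(p-1)⌉. -/

import Mathlib

/-- `S` has all pairwise distances at least `s`. -/
def stab (s : ℕ) (S : Finset ℕ) : Prop :=
  ∀ i ∈ S, ∀ j ∈ S, i ≠ j → i + s ≤ j ∨ j + s ≤ i

/-- `V n k s`: the `k`-subsets of `[n] = {1,…,n}` with pairwise distances at least `s`. -/
def V (n k s : ℕ) : Set (Finset ℕ) :=
  {S | S ⊆ Finset.Icc 1 n ∧ S.card = k ∧ stab s S}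

/-- `c` is a proper coloring of `KG^r([n] choose k)~_{s-stab}`. -/
def IsProperCol (r n k s t : ℕ) (c : Finset ℕ → Fin t) : Prop :=
  ∀ f : Fin r → Finset ℕ, (∀ i, f i ∈ V n k s) →
    (∀ i j, i ≠ j → Disjoint (f i) (f j)) → ∃ i j, c (f i) ≠ c (f j)

/-- The simplicial coboundary on functions of lists, with the empty list as augmentation. -/
def listCoboundary {α R : Type*} [CommRing R] : (List α → R) → List α → R
  | _, [] => 0
  | f, a :: l => f l - listCoboundary (fun t => f (a :: t)) l

/-- The prism operator attached to a map `u`, on functions of lists. -/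
def listPrism {α R : Type*} [CommRing R] (u : α → α) : (List α → R) → List α → R
  | _, [] => 0
  | f, a :: l => f (a :: u a :: l.map u) - listPrism u (fun t => f (a :: t)) l

section Operators

variable {α β R : Type*} [CommRing R]

theorem listCoboundary_add (f g : List α → R) (l : List α) :
    listCoboundary (f + g) l = listCoboundary f l + listCoboundary g l := by
  induction l generalizing f g with
  | nil => simp [listCoboundary]
  | cons a l ih =>
    have := ih (fun t => f (a :: t)) (fun t => g (a :: t))
    simp only [listCoboundary, Pi.add_apply]
    rw [show (fun t => f (a :: t) + g (a :: t)) =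
      (fun t => f (a :: t)) + fun t => g (a :: t) from rfl, this]
    ring

theorem listCoboundary_smul (r : R) (f : List α → R) (l : List α) :
    listCoboundary (r • f) l = r * listCoboundary f l := by
  induction l generalizing f with
  | nil => simp [listCoboundary]
  | cons a l ih =>
    have := ih (fun t => f (a :: t))
    simp only [listCoboundary, Pi.smul_apply, smul_eq_mul]
    rw [show (fun t => r * f (a :: t)) = r • (fun t => f (a :: t)) from rfl, this]
    ring

theorem listPrism_add (u : α → α) (f g : List α → R) (l : List α) :
    listPrism u (f + g) l = listPrism u f l + listPrism u g l := by
  induction l generalizing f g with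
  | nil => simp [listPrism]
  | cons a l ih =>
    have := ih (fun t => f (a :: t)) (fun t => g (a :: t))
    simp only [listPrism, Pi.add_apply]
    rw [show (fun t => f (a :: t) + g (a :: t)) =
      (fun t => f (a :: t)) + fun t => g (a :: t) from rfl, this]
    ring

theorem listPrism_smul (u : α → α) (r : R) (f : List α → R) (l : List α) :
    listPrism u (r • f) l = r * listPrism u f l := by
  induction l generalizing f with
  | nil => simp [listPrism]
  | cons a l ih =>
    have := ih (fun t => f (a :: t))
    simp only [listPrism, Pi.smul_apply, smul_eq_mul]
    rw [show (fun t => r * f (a :: t)) = r • (fun t => f (a :: t)) from rfl, this]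
    ring

variable (R) in
/-- `listCoboundary` as a linear endomorphism. -/
def coboundary (α : Type*) : Module.End R (List α → R) where
  toFun := listCoboundary
  map_add' f g := funext (listCoboundary_add f g)
  map_smul' r f := funext (listCoboundary_smul r f)

variable (R) in
/-- Pullback of functions of lists along a map of the entries. -/
def listPullback (u : α → β) : (List β → R) →ₗ[R] (List α → R) :=
  LinearMap.funLeft R R (List.map u)

variable (R) in
/-- The homotopy contracting lists to the vertex `e` through the map `u`. -/
def coneHomotopy (u : α → α) (e : α) : Module.End R (List α → R) where
  toFun f l := f (e :: l.map u) - listPrism u f l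
  map_add' f g := by
    ext l
    simp only [listPrism_add, Pi.add_apply]
    ring
  map_smul' r f := by
    ext l
    simp only [listPrism_smul, Pi.smul_apply, smul_eq_mul, RingHom.id_apply]
    ring

@[simp]
theorem coboundary_nil (f : List α → R) : coboundary R α f [] = 0 := rfl

theorem coboundary_cons (f : List α → R) (a : α) (l : List α) :
    coboundary R α f (a :: l) = f l - coboundary R α (fun t => f (a :: t)) l := rfl

@[simp]
theorem listPullback_apply (u : α → β) (f : List β → R) (l : List α) :
    listPullback R u f l = f (l.map u) := rfl

theorem coneHomotopy_apply (u : α → α) (e : α) (f : List α → R) (l : List α) :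
    coneHomotopy R u e f l = f (e :: l.map u) - listPrism u f l := rfl

theorem coboundary_coboundary (f : List α → R) (l : List α) :
    coboundary R α (coboundary R α f) l = 0 := by
  induction l generalizing f with
  | nil => rfl
  | cons a l ih =>
    have h : (fun t => coboundary R α f (a :: t)) =
        f - coboundary R α (fun t => f (a :: t)) := rfl
    rw [coboundary_cons, h, map_sub, Pi.sub_apply, ih]
    ring

theorem coboundary_mul_self : coboundary R α * coboundary R α = 0 := by
  ext f l
  exact coboundary_coboundary f l

theorem coboundary_listPullback (u : α → β) (f : List β → R) :
    coboundary R α (listPullback R u f) = listPullback R u (coboundary R β f) := by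
  ext l
  induction l generalizing f with
  | nil => rfl
  | cons a l ih =>
    have := ih (fun t => f (u a :: t))
    simp only [listPullback_apply, List.map_cons, coboundary_cons] at this ⊢
    rw [← this]
    rfl

theorem listPrism_coboundary (u : α → α) (f : List α → R) (l : List α) :
    listPrism u (coboundary R α f) l + coboundary R α (listPrism u f) l = f (l.map u) - f l := by
  induction l generalizing f with
  | nil => simp [listPrism]
  | cons a l ih =>
    have h1 : (fun t => coboundary R α f (a :: t)) =
        f + (-1 : R) • coboundary R α (fun t => f (a :: t)) := by
      ext t
      simp only [coboundary_cons, Pi.add_apply, Pi.smul_apply, smul_eq_mul]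
      ring
    have h2 : (fun t => listPrism u f (a :: t)) =
        listPullback R u (fun t => f (a :: u a :: t)) - listPrism u (fun t => f (a :: t)) := rfl
    rw [coboundary_cons, h2, map_sub, coboundary_listPullback]
    have := ih (fun t => f (a :: t))
    simp only [listPrism, h1, listPrism_add, listPrism_smul]
    simp only [coboundary_cons, Pi.sub_apply, listPullback_apply] at this ⊢
    simp only [List.map_cons]
    linear_combination this

theorem coneHomotopy_coboundary (u : α → α) (e : α) (f : List α → R) :
    coneHomotopy R u e (coboundary R α f) + coboundary R α (coneHomotopy R u e f) = f := by
  ext l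
  have h : coneHomotopy R u e f =
      listPullback R u (fun t => f (e :: t)) - listPrism u f := rfl
  rw [h, map_sub, coboundary_listPullback, Pi.add_apply, coneHomotopy_apply]
  have := listPrism_coboundary u f l
  simp only [coboundary_cons, Pi.sub_apply, listPullback_apply]
  linear_combination -this

theorem listPrism_eq_zero (u : α → α) (f : List α → R) (l : List α)
    (h : ∀ l₁ a l₂, l = l₁ ++ a :: l₂ → f (l₁ ++ a :: u a :: l₂.map u) = 0) :
    listPrism u f l = 0 := by
  induction l generalizing f with
  | nil => rfl
  | cons a l ih =>
    rw [listPrism, ih, sub_zero]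
    · exact h [] a l rfl
    rintro l₁ b l₂ rfl
    exact h (a :: l₁) b l₂ rfl

/-- A function of lists that vanishes on lists with two equal consecutive entries. -/
def ListNormalized (f : List α → R) : Prop :=
  ∀ l₁ a l₂, f (l₁ ++ a :: a :: l₂) = 0

theorem ListNormalized.coboundary {f : List α → R} (hf : ListNormalized f) :
    ListNormalized (coboundary R α f) := by
  intro l₁ a l₂
  induction l₁ generalizing f with
  | nil =>
    have : (fun t => f (a :: a :: t)) = 0 := funext fun t => hf [] a t
    simp [coboundary_cons, this]
  | cons b l₁ ih =>
    rw [List.cons_append, coboundary_cons, hf, ih fun l₃ c l₄ => hf (b :: l₃) c l₄, sub_zero]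

theorem ListNormalized.isChain_ne {f : List α → R} (hf : ListNormalized f) {l : List α}
    (hl : f l ≠ 0) : l.IsChain (· ≠ ·) := by
  rw [List.isChain_iff_forall_rel_of_append_cons_cons]
  rintro a b l₁ l₂ rfl rfl
  exact hl (hf l₁ a l₂)

end Operators

section Periodicity

variable {p : ℕ}

theorem sub_one_mul_sum_smul_pow {A : Type*} [Ring A] (T : A) (n : ℕ) :
    (T - 1) * ∑ i ∈ Finset.range n, (i : A) * T ^ i =
      n * T ^ n - T * ∑ i ∈ Finset.range n, T ^ i := by
  induction n with
  | zero => simp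
  | succ n ih =>
    rw [Finset.sum_range_succ, mul_add, ih, Finset.sum_range_succ, mul_add]
    have h : T * ((n : A) * T ^ n) = n * T ^ (n + 1) := by
      rw [← mul_assoc, (Nat.cast_commute n T).symm.eq, mul_assoc, pow_succ']
    rw [sub_mul, h, one_mul, ← pow_succ']
    push_cast
    noncomm_ring

/-- The norm element `1 + T + ⋯ + T ^ (p - 1)`. -/
def cyclicNorm {A : Type*} [Ring A] (p : ℕ) (T : A) : A := ∑ i ∈ Finset.range p, T ^ i

/-- The element `∑ i < p, i T ^ i`. -/
def cyclicMoment {A : Type*} [Ring A] (p : ℕ) (T : A) : A :=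
  ∑ i ∈ Finset.range p, (i : A) * T ^ i

/-- The differentials of the periodic resolution of the cyclic group of order `p`,
with the identity in degree zero. -/
def periodicDifferential {A : Type*} [Ring A] (p : ℕ) (T : A) (i : ℕ) : A :=
  if i = 0 then 1 else if Even i then cyclicNorm p T else T - 1

section Ring

variable {A : Type*} [Ring A] {T : A}

theorem sub_one_mul_cyclicNorm (hT : T ^ p = 1) : (T - 1) * cyclicNorm p T = 0 := by
  rw [cyclicNorm, mul_geom_sum, hT, sub_self]

theorem cyclicNorm_mul_sub_one (hT : T ^ p = 1) : cyclicNorm p T * (T - 1) = 0 := by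
  rw [cyclicNorm, geom_sum_mul, hT, sub_self]

theorem sub_one_mul_cyclicMoment (hT : T ^ p = 1) (hp : (p : A) = 0) :
    (T - 1) * cyclicMoment p T = -cyclicNorm p T := by
  have h := sub_one_mul_cyclicNorm hT
  rw [sub_mul, one_mul, sub_eq_zero] at h
  rw [cyclicMoment, sub_one_mul_sum_smul_pow, hp, zero_mul, zero_sub]
  exact congrArg _ h

theorem cyclicMoment_mul_sub_one (hT : T ^ p = 1) (hp : (p : A) = 0) :
    cyclicMoment p T * (T - 1) = -cyclicNorm p T := by
  rw [← sub_one_mul_cyclicMoment hT hp]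
  have h : Commute (cyclicMoment p T) T :=
    Commute.sum_left _ _ _ fun i _ => (Nat.cast_commute i T).mul_left (Commute.pow_self T i)
  exact (h.sub_right (Commute.one_right _)).eq

theorem commute_cyclicNorm {d : A} (h : Commute d T) : Commute d (cyclicNorm p T) :=
  Commute.sum_right _ _ _ fun i _ => h.pow_right i

theorem commute_cyclicMoment {d : A} (h : Commute d T) : Commute d (cyclicMoment p T) :=
  Commute.sum_right _ _ _ fun i _ => (Nat.commute_cast d i).mul_right (h.pow_right i)

theorem commute_periodicDifferential {d : A} (h : Commute d T) (i : ℕ) :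
    Commute d (periodicDifferential p T i) := by
  unfold periodicDifferential
  split_ifs
  · exact Commute.one_right d
  · exact commute_cyclicNorm h
  · exact h.sub_right (Commute.one_right d)

theorem periodicDifferential_mul (hT : T ^ p = 1) {i : ℕ} (hi : i ≠ 0) :
    periodicDifferential p T i * periodicDifferential p T (i + 1) = 0 := by
  unfold periodicDifferential
  by_cases h : Even i
  · simp [hi, h, Nat.even_add_one, cyclicNorm_mul_sub_one hT]
  · simp [hi, h, Nat.even_add_one, sub_one_mul_cyclicNorm hT]

end Ring

theorem commute_coboundary_listPullback {α R : Type*} [CommRing R] (u : α → α) :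
    Commute (coboundary R α) (listPullback R u) := by
  ext f : 1
  exact coboundary_listPullback u f

theorem listPullback_pow_apply {α R : Type*} [CommRing R] (u : α → α) (i : ℕ)
    (f : List α → R) (l : List α) :
    ((listPullback R u : Module.End R (List α → R)) ^ i) f l = f (l.map u^[i]) := by
  induction i generalizing l with
  | zero => simp
  | succ i ih =>
    rw [pow_succ', Module.End.mul_apply, listPullback_apply, ih, List.map_map]
    rfl

theorem listPullback_pow_eq_one {α R : Type*} [CommRing R] {u : α → α} {n : ℕ}
    (hu : u^[n] = id) : (listPullback R u : Module.End R (List α → R)) ^ n = 1 := by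
  ext f l
  rw [listPullback_pow_apply, hu]
  simp

theorem iterate_add_one (i : ℕ) : (fun x : ZMod p => x + 1)^[i] = fun x => x + (i : ZMod p) := by
  ext x
  simp

/-- The translation by one acting on functions of lists in `ZMod p`. -/
def zmodShift (p : ℕ) : Module.End (ZMod p) (List (ZMod p) → ZMod p) :=
  listPullback (ZMod p) (fun x : ZMod p => x + 1)

theorem zmodShift_apply (f : List (ZMod p) → ZMod p) (l : List (ZMod p)) :
    zmodShift p f l = f (l.map (· + 1)) := rfl

theorem zmodShift_pow_apply (i : ℕ) (f : List (ZMod p) → ZMod p) (l : List (ZMod p)) :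
    (zmodShift p ^ i) f l = f (l.map (· + (i : ZMod p))) := by
  rw [zmodShift, listPullback_pow_apply, iterate_add_one]

theorem zmodShift_pow_card : zmodShift p ^ p = 1 :=
  listPullback_pow_eq_one (by rw [iterate_add_one]; ext; simp)

theorem cyclicNorm_zmodShift_apply (f : List (ZMod p) → ZMod p) (l : List (ZMod p)) :
    cyclicNorm p (zmodShift p) f l = ∑ i ∈ Finset.range p, f (l.map (· + (i : ZMod p))) := by
  simp [cyclicNorm, zmodShift_pow_apply, LinearMap.sum_apply, Finset.sum_apply]

theorem cast_end_eq_zero {M : Type*} [AddCommGroup M] [Module (ZMod p) M] :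
    (p : Module.End (ZMod p) M) = 0 := by
  ext x
  rw [← map_natCast (algebraMap (ZMod p) (Module.End (ZMod p) M)), ZMod.natCast_self, map_zero]

variable [NeZero p]

theorem exists_cyclicNorm_eq {f : List (ZMod p) → ZMod p} (hf : ListNormalized f) (h0 : f [] = 0)
    (h : (zmodShift p - 1) f = 0) :
    ∃ g, ListNormalized g ∧ cyclicNorm p (zmodShift p) g = f := by
  have hinv : ∀ (i : ℕ) l, f (l.map (· + (i : ZMod p))) = f l := by
    intro i l
    rw [← zmodShift_pow_apply i f l]
    have h1 : zmodShift p f = f := sub_eq_zero.mp h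
    induction i with
    | zero => simp
    | succ i ih => rw [pow_succ, Module.End.mul_apply, h1, ih]
  refine ⟨fun l => if l.headD 0 = 0 then f l else 0, fun l₁ a l₂ => by simp [hf l₁ a l₂], ?_⟩
  ext l
  rw [cyclicNorm_zmodShift_apply]
  cases l with
  | nil => simp [h0]
  | cons a l =>
    rw [Finset.sum_eq_single (-a).val]
    · rw [hinv]
      simp
    · intro i hi hne
      rw [if_neg]
      intro h'
      apply hne
      have : (i : ZMod p) = -a := by
        simp only [List.map_cons, List.headD_cons] at h'
        linear_combination h'
      rw [← this, ZMod.val_cast_of_lt (Finset.mem_range.mp hi)]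
    · intro h'
      exact absurd (Finset.mem_range.mpr (ZMod.val_lt _)) h'

theorem exists_sub_one_eq {f : List (ZMod p) → ZMod p} (hf : ListNormalized f) (h0 : f [] = 0)
    (h : cyclicNorm p (zmodShift p) f = 0) :
    ∃ g, ListNormalized g ∧ (zmodShift p - 1) g = f := by
  refine ⟨fun l => ∑ j ∈ Finset.range (l.headD 0).val, f (l.map (· + ((j : ZMod p) - l.headD 0))),
    fun l₁ a l₂ => Finset.sum_eq_zero fun j _ => ?_, ?_⟩
  · simp only [List.map_append, List.map_cons]
    exact hf _ _ _
  ext l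
  rw [LinearMap.sub_apply, Pi.sub_apply, zmodShift_apply, Module.End.one_apply]
  cases l with
  | nil => simp [h0]
  | cons a l =>
    have hshift : ∀ x y : ZMod p, ((a :: l).map (· + x)).map (· + y) =
        (a :: l).map (· + (x + y)) := by
      intro x y
      simp [Function.comp_def, add_assoc]
    have hlast : (a :: l).map (· + ((a.val : ZMod p) - a)) = a :: l := by simp
    rw [List.headD_cons, show ((a :: l).map (· + 1)).headD 0 = a + 1 from rfl]
    simp only [hshift]
    have hj : ∀ j : ℕ, (1 + ((j : ZMod p) - (a + 1))) = j - a := fun j => by ring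
    simp only [hj]
    rcases Nat.lt_or_ge (a.val + 1) p with hlt | hge
    · have hv : (a + 1).val = a.val + 1 := by
        rw [← ZMod.val_cast_of_lt hlt]
        simp
      rw [hv, Finset.sum_range_succ, hlast]
      ring
    · have hap : a.val + 1 = p := le_antisymm (ZMod.val_lt a) hge
      have ha : a + 1 = 0 := by
        rw [← ZMod.natCast_zmod_val a]
        exact_mod_cast congrArg (Nat.cast : ℕ → ZMod p) hap |>.trans (ZMod.natCast_self p)
      have hN := congrFun h ((a :: l).map (· + (-a)))
      rw [cyclicNorm_zmodShift_apply, show Finset.range p = Finset.range (a.val + 1) by rw [hap],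
        Finset.sum_range_succ] at hN
      simp only [hshift, neg_add_eq_sub] at hN
      rw [hlast, Pi.zero_apply] at hN
      rw [ha, ZMod.val_zero, Finset.sum_range_zero]
      linear_combination -hN

end Periodicity

theorem exists_sub_one_or_cyclicNorm_eq {p : ℕ} [NeZero p] {i : ℕ} (hi : i ≠ 0)
    {f : List (ZMod p) → ZMod p} (hf : ListNormalized f) (h0 : f [] = 0)
    (h : periodicDifferential p (zmodShift p) (i + 1) f = 0) :
    ∃ g, ListNormalized g ∧ periodicDifferential p (zmodShift p) i g = f := by
  unfold periodicDifferential at *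
  rw [if_neg hi]
  rw [if_neg i.succ_ne_zero] at h
  by_cases hev : Even i
  · rw [if_neg (by simpa [Nat.even_add_one] using hev)] at h
    rw [if_pos hev]
    exact exists_cyclicNorm_eq hf h0 h
  · rw [if_pos (by simpa [Nat.even_add_one] using hev)] at h
    rw [if_neg hev]
    exact exists_sub_one_eq hf h0 h

theorem periodicDifferential_add_two {A : Type*} [Ring A] {p i : ℕ} {T : A} (hi : i ≠ 0) :
    periodicDifferential p T (i + 2) = periodicDifferential p T i := by
  simp [periodicDifferential, hi, Nat.even_add]

theorem coboundary_eq_zero_of_length_one {R α : Type*} [CommRing R] {f : List α → R}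
    (h1 : ∀ x, f [x] = 1) (h : ∀ l, l.length ≠ 1 → f l = 0) : coboundary R α f = 0 := by
  ext l
  match l with
  | [] => rfl
  | [a] => simp [coboundary_cons, h]
  | [a, b] => simp [coboundary_cons, h1, h]
  | a :: b :: c :: l =>
    have h0 : coboundary R α (fun _ => 0) l = 0 := congrFun (map_zero (coboundary R α)) l
    simp [coboundary_cons, h, h0]

theorem exists_normalized_resolution (p : ℕ) [NeZero p] :
    ∃ b : ℕ → List (ZMod p) → ZMod p,
      (∀ i, ListNormalized (b i)) ∧ (∀ x, b 0 [x] = if x = 0 then 1 else 0) ∧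
      ∀ i, coboundary (ZMod p) (ZMod p) (b i) =
        periodicDifferential p (zmodShift p) (i + 1) (b (i + 1)) := by
  set d := coboundary (ZMod p) (ZMod p)
  have hcomm : Commute d (zmodShift p) := commute_coboundary_listPullback _
  let good (i : ℕ) (f : List (ZMod p) → ZMod p) : Prop :=
    ListNormalized f ∧ periodicDifferential p (zmodShift p) (i + 2) (d f) = 0
  have step : ∀ i f, good i f → ∃ g, good (i + 1) g ∧
      d f = periodicDifferential p (zmodShift p) (i + 1) g := by
    rintro i f ⟨hf, h⟩
    obtain ⟨g, hg, hgf⟩ := exists_sub_one_or_cyclicNorm_eq i.succ_ne_zero hf.coboundary rfl h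
    refine ⟨g, ⟨hg, ?_⟩, hgf.symm⟩
    have := LinearMap.congr_fun (commute_periodicDifferential (p := p) hcomm (i + 1)).eq g
    rw [Module.End.mul_apply, Module.End.mul_apply, hgf] at this
    rw [show i + 1 + 2 = (i + 1) + 2 from rfl, periodicDifferential_add_two i.succ_ne_zero,
      ← this]
    exact LinearMap.congr_fun coboundary_mul_self f
  let b₀ : List (ZMod p) → ZMod p := fun l => if l = [0] then 1 else 0
  have hb₀ : good 0 b₀ := by
    refine ⟨fun l₁ a l₂ => if_neg fun h => ?_, ?_⟩
    · have := congrArg List.length h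
      simp at this
      omega
    · have h1 : periodicDifferential p (zmodShift p) 2 = cyclicNorm p (zmodShift p) := rfl
      have h2 := LinearMap.congr_fun (commute_cyclicNorm (p := p) hcomm).eq b₀
      rw [Module.End.mul_apply, Module.End.mul_apply] at h2
      rw [zero_add, h1, ← h2]
      apply coboundary_eq_zero_of_length_one
      · intro x
        rw [cyclicNorm_zmodShift_apply, Finset.sum_eq_single (-x).val]
        · simp [b₀]
        · intro i hi hne
          refine if_neg fun h' => hne ?_
          have : (i : ZMod p) = -x := by
            simp only [List.map_cons, List.map_nil, List.cons.injEq, and_true] at h'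
            linear_combination h'
          rw [← this, ZMod.val_cast_of_lt (Finset.mem_range.mp hi)]
        · intro h'
          exact absurd (Finset.mem_range.mpr (ZMod.val_lt _)) h'
      · intro l hl
        rw [cyclicNorm_zmodShift_apply]
        refine Finset.sum_eq_zero fun i _ => if_neg fun h => hl ?_
        simpa using congrArg List.length h
  choose! g hg hgd using step
  let b : ∀ i, {f // good i f} := fun i =>
    Nat.rec ⟨b₀, hb₀⟩ (fun i f => ⟨g i f.1, hg i f.1 f.2⟩) i
  exact ⟨fun i => (b i).1, fun i => (b i).2.1, fun x => by simp [b, b₀],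
    fun i => hgd i (b i).1 (b i).2⟩

section ConeFunctional

variable {P R : Type*} [CommRing R]

/-- The functional on functions of lists dual to an iterated cone construction: at each stage the
differential of the periodic resolution is followed by a cone. -/
def coneFunctional (R : Type*) [CommRing R] (p : ℕ) (ν : P → P) (u : ℕ → P → P) (e : ℕ → P) :
    ℕ → (List P → R) →ₗ[R] R
  | 0 => LinearMap.proj []
  | i + 1 => coneFunctional R p ν u e i ∘ₗ
      (periodicDifferential p (listPullback R ν : Module.End R (List P → R)) i *
        coneHomotopy R (u i) (e i))

variable {p : ℕ} {ν : P → P} {u : ℕ → P → P} {e : ℕ → P}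

theorem coneFunctional_succ (i : ℕ) (f : List P → R) :
    coneFunctional R p ν u e (i + 1) f = coneFunctional R p ν u e i
      (periodicDifferential p (listPullback R ν : Module.End R (List P → R)) i
        (coneHomotopy R (u i) (e i) f)) := rfl

theorem coneFunctional_coboundary (hν : ν^[p] = id) (i : ℕ) (f : List P → R) :
    coneFunctional R p ν u e (i + 1) (coboundary R P f) = coneFunctional R p ν u e i
      (periodicDifferential p (listPullback R ν : Module.End R (List P → R)) i f) := by
  have hT := listPullback_pow_eq_one (R := R) hν
  have hH : ∀ i f, coneHomotopy R (u i) (e i) (coboundary R P f) =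
      f - coboundary R P (coneHomotopy R (u i) (e i) f) := fun i f =>
    eq_sub_of_add_eq (coneHomotopy_coboundary (u i) (e i) f)
  have hd : ∀ i g, periodicDifferential p (listPullback R ν : Module.End R (List P → R)) i
      (coboundary R P g) = coboundary R P
        (periodicDifferential p (listPullback R ν : Module.End R (List P → R)) i g) := fun i g =>
    (LinearMap.congr_fun
      (commute_periodicDifferential (commute_coboundary_listPullback (R := R) ν) i).eq g).symm
  induction i generalizing f with
  | zero =>
    rw [coneFunctional_succ, hH, map_sub, map_sub, hd, sub_eq_self]
    rfl
  | succ i ih =>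
    rw [coneFunctional_succ, hH, map_sub, map_sub, hd, sub_eq_self, ih]
    rcases eq_or_ne i 0 with rfl | hi
    · exact sub_self _
    · rw [← Module.End.mul_apply, periodicDifferential_mul hT hi]
      simp

variable [Preorder P]

/-- Weakly increasing lists of length `i` with entries in `s`. -/
def IsFlag (s : Set P) (i : ℕ) (l : List P) : Prop :=
  l.length = i ∧ l.Pairwise (· ≤ ·) ∧ ∀ x ∈ l, x ∈ s

/-- The data of a filtration by invariant subsets, each of which contracts to a point
inside the next one. -/
structure ConeFiltration (p : ℕ) (ν : P → P) (u : ℕ → P → P) (e : ℕ → P) (G : ℕ → Set P) :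
    Prop where
  iterate_eq : ν^[p] = id
  monotone : Monotone ν
  map_mem : ∀ i, ∀ x ∈ G i, ν x ∈ G i
  mem_succ : ∀ i, ∀ x ∈ G i, x ∈ G (i + 1)
  apex_mem : ∀ i, e i ∈ G (i + 1)
  cone_mem : ∀ i, ∀ x ∈ G i, u i x ∈ G (i + 1)
  cone_mono : ∀ i, Monotone (u i)
  le_cone : ∀ i, ∀ x ∈ G i, x ≤ u i x
  apex_le_cone : ∀ i, ∀ x ∈ G i, e i ≤ u i x

namespace ConeFiltration

variable {G : ℕ → Set P} (h : ConeFiltration p ν u e G)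

include h

theorem isFlag_map {i : ℕ} {l : List P} (hl : IsFlag (G i) i l) : IsFlag (G i) i (l.map ν) := by
  obtain ⟨h1, h2, h3⟩ := hl
  refine ⟨by simpa, h2.map ν fun _ _ hxy => h.monotone hxy, ?_⟩
  simpa using fun x hx => h.map_mem i x (h3 x hx)

theorem isFlag_apex_cons {i : ℕ} {l : List P} (hl : IsFlag (G i) i l) :
    IsFlag (G (i + 1)) (i + 1) (e i :: l.map (u i)) := by
  obtain ⟨h1, h2, h3⟩ := hl
  refine ⟨by simpa, List.pairwise_cons.mpr ⟨?_, h2.map _ fun _ _ hxy => h.cone_mono i hxy⟩, ?_⟩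
  · simpa using fun x hx => h.apex_le_cone i x (h3 x hx)
  · simpa using ⟨h.apex_mem i, fun x hx => h.cone_mem i x (h3 x hx)⟩

theorem isFlag_prism {i : ℕ} {l₁ l₂ : List P} {a : P} (hl : IsFlag (G i) i (l₁ ++ a :: l₂)) :
    IsFlag (G (i + 1)) (i + 1) (l₁ ++ a :: u i a :: l₂.map (u i)) := by
  obtain ⟨h1, h2, h3⟩ := hl
  have hle : ∀ x ∈ a :: l₂, x ≤ u i x := fun x hx => h.le_cone i x (h3 x (by simp_all))
  rw [List.pairwise_append, List.pairwise_cons] at h2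
  obtain ⟨hp1, ⟨hp2, hp3⟩, hp4⟩ := h2
  refine ⟨by simp at h1 ⊢; omega, ?_, ?_⟩
  · have h5 : (u i a :: l₂.map (u i)).Pairwise (· ≤ ·) :=
      (List.pairwise_cons.mpr ⟨hp2, hp3⟩).map _ fun _ _ hxy => h.cone_mono i hxy
    rw [List.pairwise_append, List.pairwise_cons]
    have h6 : ∀ y ∈ u i a :: l₂.map (u i), a ≤ y := by
      intro y hy
      simp only [List.mem_cons, List.mem_map] at hy
      rcases hy with rfl | ⟨z, hz, rfl⟩
      · exact hle a (by simp)
      · exact (hp2 z hz).trans (hle z (by simp [hz]))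
    refine ⟨hp1, ⟨h6, h5⟩, fun x hx y hy => ?_⟩
    have hxa : x ≤ a := hp4 x hx a (by simp)
    rcases List.mem_cons.mp hy with rfl | hy
    · exact hxa
    · exact hxa.trans (h6 y hy)
  · intro x hx
    simp only [List.mem_append, List.mem_cons, List.mem_map] at hx
    rcases hx with hx | rfl | rfl | ⟨z, hz, rfl⟩
    · exact h.mem_succ i x (h3 x (by simp [hx]))
    · exact h.mem_succ i x (h3 x (by simp))
    · exact h.cone_mem i a (h3 a (by simp))
    · exact h.cone_mem i z (h3 z (by simp [hz]))

theorem listPullback_pow_eq_zero {i : ℕ} (f : List P → R)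
    (hf : ∀ l, IsFlag (G i) i l → f l = 0) (j : ℕ) (l : List P) (hl : IsFlag (G i) i l) :
    ((listPullback R ν : Module.End R (List P → R)) ^ j) f l = 0 := by
  induction j generalizing l with
  | zero => exact hf l hl
  | succ j ih =>
    rw [pow_succ', Module.End.mul_apply]
    exact ih _ (h.isFlag_map hl)

theorem periodicDifferential_eq_zero {i : ℕ} (j : ℕ) (f : List P → R)
    (hf : ∀ l, IsFlag (G i) i l → f l = 0) (l : List P) (hl : IsFlag (G i) i l) :
    periodicDifferential p (listPullback R ν : Module.End R (List P → R)) j f l = 0 := by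
  unfold periodicDifferential
  split_ifs
  · exact hf l hl
  · rw [cyclicNorm, LinearMap.sum_apply, Finset.sum_apply]
    exact Finset.sum_eq_zero fun k _ => h.listPullback_pow_eq_zero f hf k l hl
  · have := h.listPullback_pow_eq_zero f hf 1 l hl
    rw [pow_one] at this
    rw [LinearMap.sub_apply, Pi.sub_apply, this, Module.End.one_apply, hf l hl, sub_zero]

theorem coneFunctional_eq_zero {i : ℕ} (f : List P → R)
    (hf : ∀ l, IsFlag (G i) i l → f l = 0) : coneFunctional R p ν u e i f = 0 := by
  induction i generalizing f with
  | zero => exact hf [] (by simp [IsFlag])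
  | succ i ih =>
    rw [coneFunctional_succ]
    refine ih _ (h.periodicDifferential_eq_zero i _ fun l hl => ?_)
    rw [coneHomotopy_apply, hf _ (h.isFlag_apex_cons hl), listPrism_eq_zero, sub_zero]
    rintro l₁ a l₂ rfl
    exact hf _ (h.isFlag_prism hl)

theorem coneFunctional_congr {i : ℕ} (f g : List P → R)
    (hfg : ∀ l, IsFlag (G i) i l → f l = g l) :
    coneFunctional R p ν u e i f = coneFunctional R p ν u e i g := by
  rw [← sub_eq_zero, ← map_sub]
  exact h.coneFunctional_eq_zero _ fun l hl => sub_eq_zero.mpr (hfg l hl)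

variable {σ : P → ZMod p} (hσ : ∀ i, ∀ x ∈ G i, σ (ν x) = σ x + 1)

include hσ

theorem coneFunctional_shift_pow (i j : ℕ) (f : List (ZMod p) → ZMod p) :
    coneFunctional (ZMod p) p ν u e i
        (((listPullback (ZMod p) ν : Module.End (ZMod p) (List P → ZMod p)) ^ j)
          (listPullback (ZMod p) σ f)) =
      coneFunctional (ZMod p) p ν u e i (listPullback (ZMod p) σ ((zmodShift p ^ j) f)) := by
  have hmem : ∀ j, ∀ x ∈ G i, ν^[j] x ∈ G i := by
    intro j x hx
    induction j with
    | zero => exact hx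
    | succ j ih => rw [Function.iterate_succ_apply']; exact h.map_mem i _ ih
  have hiter : ∀ x ∈ G i, σ (ν^[j] x) = σ x + j := by
    intro x hx
    induction j with
    | zero => simp
    | succ j ih =>
      rw [Function.iterate_succ_apply', hσ i _ (hmem j x hx), ih]
      push_cast
      ring
  refine h.coneFunctional_congr _ _ fun l hl => ?_
  rw [listPullback_pow_apply, listPullback_apply, listPullback_apply, zmodShift_pow_apply,
    List.map_map, List.map_map]
  exact congrArg f (List.map_congr_left fun x hx => hiter x (hl.2.2 x hx))

theorem coneFunctional_cyclicNorm (i : ℕ) (f : List (ZMod p) → ZMod p) :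
    coneFunctional (ZMod p) p ν u e i
        (cyclicNorm p (listPullback (ZMod p) ν : Module.End (ZMod p) (List P → ZMod p))
          (listPullback (ZMod p) σ f)) =
      coneFunctional (ZMod p) p ν u e i
        (listPullback (ZMod p) σ (cyclicNorm p (zmodShift p) f)) := by
  simp only [cyclicNorm, LinearMap.sum_apply, map_sum, h.coneFunctional_shift_pow hσ]

theorem coneFunctional_sub_one (i : ℕ) (f : List (ZMod p) → ZMod p) :
    coneFunctional (ZMod p) p ν u e i
        (((listPullback (ZMod p) ν : Module.End (ZMod p) (List P → ZMod p)) - 1)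
          (listPullback (ZMod p) σ f)) =
      coneFunctional (ZMod p) p ν u e i (listPullback (ZMod p) σ ((zmodShift p - 1) f)) := by
  have := h.coneFunctional_shift_pow hσ i 1 f
  rw [pow_one, pow_one] at this
  rw [LinearMap.sub_apply, LinearMap.sub_apply, map_sub, map_sub, map_sub, this]
  rfl

theorem coneFunctional_cyclicNorm_eq_one [NeZero p] {b : ℕ → List (ZMod p) → ZMod p}
    (hb₀ : ∀ x, b 0 [x] = if x = 0 then 1 else 0)
    (hb : ∀ i, coboundary (ZMod p) (ZMod p) (b i) =
        periodicDifferential p (zmodShift p) (i + 1) (b (i + 1))) (i : ℕ) :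
    coneFunctional (ZMod p) p ν u e (i + 1)
      (listPullback (ZMod p) σ (cyclicNorm p (zmodShift p) (b i))) = 1 := by
  induction i with
  | zero =>
    change cyclicNorm p (zmodShift p) (b 0) [σ (e 0)] - 0 = 1
    rw [sub_zero, cyclicNorm_zmodShift_apply, Finset.sum_eq_single (-σ (e 0)).val]
    · simp [hb₀]
    · intro i hi hne
      rw [List.map_singleton, hb₀]
      refine if_neg fun h' => hne ?_
      have : (i : ZMod p) = -σ (e 0) := by linear_combination h'
      rw [← this, ZMod.val_cast_of_lt (Finset.mem_range.mp hi)]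
    · intro h'
      exact absurd (Finset.mem_range.mpr (ZMod.val_lt _)) h'
  | succ i ih =>
    have hcob := coneFunctional_coboundary (R := ZMod p) (u := u) (e := e) h.iterate_eq (i + 1)
    have hbi := hb i
    rw [← ih]
    unfold periodicDifferential at hcob hbi
    rw [if_neg i.succ_ne_zero] at hcob hbi
    by_cases hev : Even (i + 1)
    · rw [if_pos hev] at hcob hbi
      rw [← hbi, ← coboundary_listPullback, hcob, h.coneFunctional_cyclicNorm hσ]
    · rw [if_neg hev] at hcob hbi
      have hM := LinearMap.congr_fun (commute_cyclicMoment (p := p)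
        (commute_coboundary_listPullback (R := ZMod p) (fun x : ZMod p => x + 1))).eq (b i)
      have h1 := LinearMap.congr_fun
        (sub_one_mul_cyclicMoment (zmodShift_pow_card (p := p)) cast_end_eq_zero) (b i)
      have h2 := LinearMap.congr_fun
        (cyclicMoment_mul_sub_one (zmodShift_pow_card (p := p)) cast_end_eq_zero) (b (i + 1))
      rw [Module.End.mul_apply, LinearMap.neg_apply] at h1 h2
      rw [neg_eq_iff_eq_neg.mp h1.symm, neg_eq_iff_eq_neg.mp h2.symm, map_neg, map_neg, map_neg,
        map_neg, neg_inj, ← hbi, ← h.coneFunctional_sub_one hσ, ← hcob, coboundary_listPullback]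
      exact congrArg _ (congrArg _ hM.symm)

/-- A generalisation of Fan's lemma to cyclic group actions. -/
theorem exists_isFlag_isChain_ne [Fact (1 < p)] {n : ℕ} (hn : n ≠ 0) :
    ∃ l, IsFlag (G n) n l ∧ (l.map σ).IsChain (· ≠ ·) := by
  have : NeZero p := ⟨(zero_lt_one.trans (Fact.out : 1 < p)).ne'⟩
  obtain ⟨i, rfl⟩ := Nat.exists_eq_succ_of_ne_zero hn
  obtain ⟨b, hnorm, hb₀, hb⟩ := exists_normalized_resolution p
  by_contra! hcon
  have hone := h.coneFunctional_cyclicNorm_eq_one hσ hb₀ hb i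
  refine zero_ne_one (α := ZMod p) (Eq.trans (Eq.symm ?_) hone)
  refine h.coneFunctional_eq_zero _ fun l hl => ?_
  by_contra hne
  have hN : ListNormalized (cyclicNorm p (zmodShift p) (b i)) := by
    intro l₁ a l₂
    rw [cyclicNorm_zmodShift_apply]
    refine Finset.sum_eq_zero fun j _ => ?_
    simp only [List.map_append, List.map_cons]
    exact hnorm i _ _ _
  exact hcon l hl (hN.isChain_ne hne)

end ConeFiltration

end ConeFunctional
theorem stab.mono {s : ℕ} {S T : Finset ℕ} (hT : stab s T) (h : S ⊆ T) : stab s S :=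
  fun i hi j hj => hT i (h hi) j (h hj)

theorem stab.insert_of_le {s m : ℕ} {S : Finset ℕ} (hS : stab s S) (h : ∀ x ∈ S, m + s ≤ x) :
    stab s (insert m S) := by
  intro i hi j hj hij
  rcases Finset.mem_insert.mp hi with rfl | hi' <;> rcases Finset.mem_insert.mp hj with rfl | hj'
  · exact absurd rfl hij
  · exact Or.inl (h j hj')
  · exact Or.inr (h i hi')
  · exact hS i hi' j hj' hij

open Classical in
/-- The maximal size of a subset of `S` with pairwise distances at least `2`. -/
noncomputable def stabRank (S : Finset ℕ) : ℕ :=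
  (S.powerset.filter (stab 2)).sup Finset.card

theorem card_le_stabRank {S T : Finset ℕ} (hS : stab 2 S) (h : S ⊆ T) : S.card ≤ stabRank T := by
  classical
  exact Finset.le_sup (f := Finset.card)
    (Finset.mem_filter.mpr ⟨Finset.mem_powerset.mpr h, hS⟩)

theorem exists_card_eq_stabRank (T : Finset ℕ) :
    ∃ S ⊆ T, stab 2 S ∧ S.card = stabRank T := by
  classical
  have hne : (T.powerset.filter (stab 2)).Nonempty :=
    ⟨∅, by simp [stab]⟩
  obtain ⟨S, hS, h⟩ := Finset.exists_mem_eq_sup _ hne Finset.card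
  rw [Finset.mem_filter, Finset.mem_powerset] at hS
  exact ⟨S, hS.1, hS.2, h.symm⟩

theorem stabRank_mono : Monotone stabRank := by
  intro S T h
  obtain ⟨U, hU, hst, hc⟩ := exists_card_eq_stabRank S
  rw [← hc]
  exact card_le_stabRank hst (hU.trans h)

section SignedSets

variable {p : ℕ}

/-- Families of pairwise disjoint subsets of `[i]` indexed by `ZMod p`, not all empty. -/
def signedSets (p i : ℕ) : Set (ZMod p → Finset ℕ) :=
  {X | (∀ j, X j ⊆ Finset.Icc 1 i) ∧ (∀ j j', j ≠ j' → Disjoint (X j) (X j')) ∧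
    ∃ j, (X j).Nonempty}

/-- Cyclic shift of the signs. -/
def signShift (X : ZMod p → Finset ℕ) : ZMod p → Finset ℕ := fun j => X (j - 1)

/-- The family whose only element is `i + 1`, with sign `0`. -/
def signApex (p i : ℕ) : ZMod p → Finset ℕ := fun j => if j = 0 then {i + 1} else ∅

theorem coneFiltration_signedSets (p : ℕ) :
    ConeFiltration p (signShift (p := p)) (fun i X => X ⊔ signApex p i) (signApex p)
      (signedSets p) where
  iterate_eq := by
    have h : ∀ i : ℕ, (signShift (p := p))^[i] = fun X j => X (j - i) := by
      intro i
      induction i with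
      | zero => ext; simp
      | succ i ih =>
        ext X j : 2
        rw [Function.iterate_succ_apply', ih]
        simp only [signShift]
        congr 1
        push_cast
        ring
    rw [h]
    ext
    simp
  monotone X Y h j := h (j - 1)
  map_mem := by
    rintro i X ⟨h1, h2, j, h3⟩
    refine ⟨fun j => h1 _, fun j j' hj => h2 _ _ (by simpa using hj), j + 1, ?_⟩
    simpa [signShift] using h3
  mem_succ := by
    rintro i X ⟨h1, h2, h3⟩
    exact ⟨fun j => (h1 j).trans (Finset.Icc_subset_Icc_right i.le_succ), h2, h3⟩
  apex_mem i := by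
    refine ⟨fun j => ?_, fun j j' hj => ?_, 0, by simp [signApex]⟩
    · unfold signApex
      split_ifs <;> simp
    · unfold signApex
      split_ifs with h1 h2
      · exact absurd (h1.trans h2.symm) hj
      all_goals simp
  cone_mem := by
    rintro i X ⟨h1, h2, j, h3⟩
    have hX : ∀ j, i + 1 ∉ X j := fun j hj => by
      have := Finset.mem_Icc.mp (h1 j hj)
      omega
    refine ⟨fun j => ?_, fun j j' hj => ?_, j, h3.mono Finset.subset_union_left⟩
    · refine Finset.union_subset ((h1 j).trans (Finset.Icc_subset_Icc_right i.le_succ)) ?_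
      unfold signApex
      split_ifs <;> simp
    · have := h2 j j' hj
      change Disjoint (X j ∪ signApex p i j) (X j' ∪ signApex p i j')
      unfold signApex
      split_ifs with h4 h5
      · exact absurd (h4.trans h5.symm) hj
      all_goals simp [hX, this]
  cone_mono i X Y h := sup_le_sup_right h _
  le_cone i X _ := le_sup_left
  apex_le_cone i X _ := le_sup_right

/-- `j` is the sign of the smallest element of the family `X`. -/
def IsFirstSign (X : ZMod p → Finset ℕ) (j : ZMod p) : Prop :=
  ∃ m ∈ X j, ∀ i, ∀ x ∈ X i, m ≤ x

theorem exists_isFirstSign {i : ℕ} {X : ZMod p → Finset ℕ} (hX : X ∈ signedSets p i) :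
    ∃ j, IsFirstSign X j := by
  classical
  obtain ⟨-, -, j₀, x₀, hx₀⟩ := hX
  have hex : ∃ m, ∃ j, m ∈ X j := ⟨x₀, j₀, hx₀⟩
  obtain ⟨j, hj⟩ := Nat.find_spec hex
  exact ⟨j, _, hj, fun i x hx => Nat.find_min' hex ⟨i, hx⟩⟩

theorem IsFirstSign.unique {i : ℕ} {X : ZMod p → Finset ℕ} (hX : X ∈ signedSets p i)
    {j j' : ZMod p} (h : IsFirstSign X j) (h' : IsFirstSign X j') : j = j' := by
  obtain ⟨m, hm, hmin⟩ := h
  obtain ⟨m', hm', hmin'⟩ := h'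
  obtain rfl : m = m' := le_antisymm (hmin _ _ hm') (hmin' _ _ hm)
  by_contra hne
  exact Finset.disjoint_left.mp (hX.2.1 _ _ hne) hm hm'

/-- The sign of the smallest element. -/
noncomputable def firstSign (X : ZMod p → Finset ℕ) : ZMod p := Classical.epsilon (IsFirstSign X)

theorem firstSign_eq {i : ℕ} {X : ZMod p → Finset ℕ} (hX : X ∈ signedSets p i) {j : ZMod p}
    (h : IsFirstSign X j) : firstSign X = j :=
  IsFirstSign.unique hX (Classical.epsilon_spec ⟨j, h⟩) h

theorem firstSign_signShift {i : ℕ} {X : ZMod p → Finset ℕ} (hX : X ∈ signedSets p i) :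
    firstSign (signShift X) = firstSign X + 1 := by
  obtain ⟨j, m, hm, hmin⟩ := exists_isFirstSign hX
  rw [firstSign_eq hX ⟨m, hm, hmin⟩]
  refine firstSign_eq ((coneFiltration_signedSets p).map_mem i X hX)
    ⟨m, by simpa [signShift] using hm, fun i x hx => hmin _ x hx⟩

theorem firstSign_eq_of_stabRank_eq {i : ℕ} {X Y : ZMod p → Finset ℕ} (hX : X ∈ signedSets p i)
    (hY : Y ∈ signedSets p i) (hle : X ≤ Y) (h : ∀ j, stabRank (X j) = stabRank (Y j)) :
    firstSign X = firstSign Y := by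
  obtain ⟨j', m', hm', hmin'⟩ := exists_isFirstSign hX
  obtain ⟨j, m, hm, hmin⟩ := exists_isFirstSign hY
  rw [firstSign_eq hX ⟨m', hm', hmin'⟩, firstSign_eq hY ⟨m, hm, hmin⟩]
  by_contra hne
  have hlt : m < m' := by
    refine lt_of_le_of_ne (hmin _ _ (hle j' hm')) ?_
    rintro rfl
    exact Finset.disjoint_left.mp (hY.2.1 _ _ hne) (hle j' hm') hm
  have hXj : ∀ x ∈ X j, m + 2 ≤ x := by
    intro x hx
    have h1 := hmin' _ _ hx
    have h2 : m' ≠ x := by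
      rintro rfl
      exact Finset.disjoint_left.mp (hX.2.1 _ _ hne) hm' hx
    omega
  obtain ⟨S, hS, hst, hc⟩ := exists_card_eq_stabRank (X j)
  have hS2 : ∀ x ∈ S, m + 2 ≤ x := fun x hx => hXj x (hS hx)
  have hmS : m ∉ S := fun hmem => by
    have := hS2 m hmem
    omega
  have := card_le_stabRank (hst.insert_of_le hS2)
    (Finset.insert_subset hm (hS.trans (hle j)))
  rw [Finset.card_insert_of_notMem hmS, hc, h j] at this
  omega

/-- The arithmetic mean of a finite set of residues. -/
noncomputable def residueMean [Fact p.Prime] (A : Finset (ZMod p)) : ZMod p :=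
  (∑ a ∈ A, a) / (A.card : ZMod p)

theorem residueMean_map_add_one [Fact p.Prime] {A : Finset (ZMod p)} (hA : A.Nonempty)
    (hlt : A.card < p) :
    residueMean (A.map (addRightEmbedding 1)) = residueMean A + 1 := by
  have h : (A.card : ZMod p) ≠ 0 := by
    rw [Ne, ZMod.natCast_eq_zero_iff]
    exact Nat.not_dvd_of_pos_of_lt hA.card_pos hlt
  unfold residueMean
  rw [Finset.sum_map, Finset.card_map]
  simp only [addRightEmbedding_apply, Finset.sum_add_distrib, Finset.sum_const, nsmul_eq_mul,
    mul_one]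
  rw [add_div, div_self h]

open Classical in
/-- The signs whose part contains a set of `V n k 2` of color `a`. -/
noncomputable def colorSigns [NeZero p] (n k : ℕ) {t : ℕ} (c : Finset ℕ → Fin t)
    (X : ZMod p → Finset ℕ) (a : Fin t) : Finset (ZMod p) :=
  Finset.univ.filter fun j => ∃ S ∈ V n k 2, S ⊆ X j ∧ c S = a

/-- The level of a family of sets, counting ranks below `k` and signs in each color. -/
noncomputable def colorLevel [NeZero p] (n k : ℕ) {t : ℕ} (c : Finset ℕ → Fin t)
    (X : ZMod p → Finset ℕ) : ℕ :=
  ∑ j, min (stabRank (X j)) (k - 1) + ∑ a, (colorSigns n k c X a).card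

open Classical in
/-- The mean of a nonempty member of the family `A`, or `x` if all members are empty. -/
noncomputable def selectSign [Fact p.Prime] {t : ℕ} [Nonempty (Fin t)]
    (A : Fin t → Finset (ZMod p)) (x : ZMod p) : ZMod p :=
  if (A (Classical.epsilon fun a => (A a).Nonempty)).Nonempty then
    residueMean (A (Classical.epsilon fun a => (A a).Nonempty)) else x

theorem selectSign_map_add_one [Fact p.Prime] {t : ℕ} [Nonempty (Fin t)]
    {A : Fin t → Finset (ZMod p)} (hA : ∀ a, (A a).card < p) (x : ZMod p) :
    selectSign (fun a => (A a).map (addRightEmbedding 1)) (x + 1) = selectSign A x + 1 := by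
  unfold selectSign
  simp only [Finset.map_nonempty]
  split_ifs with h
  · exact residueMean_map_add_one h (hA _)
  · rfl

variable {n k t : ℕ} {c : Finset ℕ → Fin t}

theorem mem_colorSigns [NeZero p] {X : ZMod p → Finset ℕ} {a : Fin t} {j : ZMod p} :
    j ∈ colorSigns n k c X a ↔ ∃ S ∈ V n k 2, S ⊆ X j ∧ c S = a := by
  simp [colorSigns]

theorem colorSigns_mono [NeZero p] {X Y : ZMod p → Finset ℕ} (h : X ≤ Y) (a : Fin t) :
    colorSigns n k c X a ⊆ colorSigns n k c Y a := by
  intro j hj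
  rw [mem_colorSigns] at hj ⊢
  obtain ⟨S, hS, hSX, hc⟩ := hj
  exact ⟨S, hS, hSX.trans (h j), hc⟩

theorem colorSigns_signShift [NeZero p] (X : ZMod p → Finset ℕ) (a : Fin t) :
    colorSigns n k c (signShift X) a =
      (colorSigns n k c X a).map (addRightEmbedding 1) := by
  ext j
  simp only [Finset.mem_map, mem_colorSigns, addRightEmbedding_apply, signShift]
  constructor
  · intro h
    exact ⟨j - 1, h, by ring⟩
  · rintro ⟨i, h, rfl⟩
    simpa using h

theorem card_colorSigns_lt [NeZero p] (hc : IsProperCol p n k 2 t c) {i : ℕ}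
    {X : ZMod p → Finset ℕ} (hX : X ∈ signedSets p i) (a : Fin t) :
    (colorSigns n k c X a).card < p := by
  by_contra! hge
  have huniv : colorSigns n k c X a = Finset.univ := by
    rw [← Finset.card_eq_iff_eq_univ, ZMod.card]
    exact le_antisymm ((Finset.card_le_univ _).trans_eq (ZMod.card p)) hge
  have hall : ∀ j, ∃ S ∈ V n k 2, S ⊆ X j ∧ c S = a := fun j =>
    mem_colorSigns.mp (huniv ▸ Finset.mem_univ j)
  choose S hSV hSX hSc using hall
  let φ : Fin p ≃ ZMod p := (ZMod.finEquiv p).toEquiv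
  obtain ⟨i, j, hij⟩ := hc (fun i => S (φ i)) (fun i => hSV _) fun i j hij =>
    Finset.disjoint_of_subset_left (hSX _) (Finset.disjoint_of_subset_right (hSX _)
      (hX.2.1 _ _ (φ.injective.ne hij)))
  exact hij ((hSc _).trans (hSc _).symm)

theorem exists_mem_colorSigns [NeZero p] {X : ZMod p → Finset ℕ} (hX : X ∈ signedSets p n)
    {j : ZMod p} (hj : k ≤ stabRank (X j)) : ∃ a, j ∈ colorSigns n k c X a := by
  obtain ⟨T, hT, hst, hcard⟩ := exists_card_eq_stabRank (X j)
  obtain ⟨S, hST, hS⟩ := Finset.exists_subset_card_eq (hcard ▸ hj)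
  exact ⟨c S, mem_colorSigns.mpr
    ⟨S, ⟨(hST.trans hT).trans (hX.1 j), hS, hst.mono hST⟩, hST.trans hT, rfl⟩⟩

theorem colorLevel_mono [NeZero p] : Monotone (colorLevel (p := p) n k c) := fun _ _ h =>
  add_le_add
    (Finset.sum_le_sum fun j _ => min_le_min_right _ (stabRank_mono (h j)))
    (Finset.sum_le_sum fun a _ => Finset.card_le_card (colorSigns_mono h a))

theorem colorLevel_pos [NeZero p] {X : ZMod p → Finset ℕ} (hX : X ∈ signedSets p n) :
    0 < colorLevel n k c X := by
  obtain ⟨j, x, hx⟩ := hX.2.2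
  have hrank : 1 ≤ stabRank (X j) := by
    have := card_le_stabRank (S := {x}) (T := X j)
      (fun a ha b hb hab => absurd ((Finset.mem_singleton.mp ha).trans
        (Finset.mem_singleton.mp hb).symm) hab) (Finset.singleton_subset_iff.mpr hx)
    simpa using this
  by_cases hk : k ≤ 1
  · obtain ⟨a, ha⟩ := exists_mem_colorSigns (c := c) hX (hk.trans hrank)
    exact Nat.add_pos_right _ (Finset.sum_pos' (fun _ _ => Nat.zero_le _)
      ⟨a, Finset.mem_univ a, Finset.card_pos.mpr ⟨j, ha⟩⟩)
  · exact Nat.add_pos_left (Finset.sum_pos' (fun _ _ => Nat.zero_le _)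
      ⟨j, Finset.mem_univ j, by omega⟩) _

theorem colorLevel_le [NeZero p] (hc : IsProperCol p n k 2 t c) {X : ZMod p → Finset ℕ}
    (hX : X ∈ signedSets p n) : colorLevel n k c X ≤ p * (k - 1) + t * (p - 1) := by
  refine add_le_add ?_ ?_
  · refine (Finset.sum_le_card_nsmul _ _ (k - 1) fun j _ => min_le_right _ _).trans_eq ?_
    simp [ZMod.card]
  · refine (Finset.sum_le_card_nsmul _ _ (p - 1) fun a _ => ?_).trans_eq ?_
    · exact Nat.le_sub_one_of_lt (card_colorSigns_lt hc hX a)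
    · simp

/-- The sign attached to a family of sets. -/
noncomputable def colorSign [Fact p.Prime] (n k : ℕ) {t : ℕ} [Nonempty (Fin t)]
    (c : Finset ℕ → Fin t) (X : ZMod p → Finset ℕ) : ZMod p :=
  selectSign (colorSigns n k c X) (firstSign X)

theorem colorSign_signShift [Fact p.Prime] [Nonempty (Fin t)] (hc : IsProperCol p n k 2 t c)
    {i : ℕ} {X : ZMod p → Finset ℕ} (hX : X ∈ signedSets p i) :
    colorSign n k c (signShift X) = colorSign n k c X + 1 := by
  unfold colorSign
  rw [firstSign_signShift hX, ← selectSign_map_add_one fun a => card_colorSigns_lt hc hX a]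
  congr 1
  ext a : 1
  exact colorSigns_signShift X a

theorem colorSign_eq_of_colorLevel_eq [Fact p.Prime] [Nonempty (Fin t)] (hk : 1 ≤ k)
    {X Y : ZMod p → Finset ℕ} (hX : X ∈ signedSets p n) (hY : Y ∈ signedSets p n) (hle : X ≤ Y)
    (h : colorLevel n k c X = colorLevel n k c Y) : colorSign n k c X = colorSign n k c Y := by
  have h1 : ∀ j ∈ Finset.univ, min (stabRank (X j)) (k - 1) ≤ min (stabRank (Y j)) (k - 1) :=
    fun j _ => min_le_min_right _ (stabRank_mono (hle j))
  have h2 : ∀ a ∈ Finset.univ, (colorSigns n k c X a).card ≤ (colorSigns n k c Y a).card :=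
    fun a _ => Finset.card_le_card (colorSigns_mono hle a)
  have hs1 := Finset.sum_le_sum h1
  have hs2 := Finset.sum_le_sum h2
  unfold colorLevel at h
  have hr := (Finset.sum_eq_sum_iff_of_le h1).mp (by omega)
  have hcol := (Finset.sum_eq_sum_iff_of_le h2).mp (by omega)
  have hcolor : colorSigns n k c X = colorSigns n k c Y := funext fun a =>
    Finset.eq_of_subset_of_card_le (colorSigns_mono hle a) (hcol a (Finset.mem_univ a)).ge
  unfold colorSign
  rw [← hcolor]
  by_cases hne : ∃ a, (colorSigns n k c X a).Nonempty
  · obtain ⟨a, ha⟩ := hne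
    have := Classical.epsilon_spec (p := fun a => (colorSigns n k c X a).Nonempty) ⟨a, ha⟩
    simp only [selectSign, if_pos this]
  · push Not at hne
    rw [firstSign_eq_of_stabRank_eq hX hY hle]
    intro j
    have hXj : stabRank (X j) < k := by
      by_contra! hge
      obtain ⟨a, ha⟩ := exists_mem_colorSigns (c := c) hX hge
      simp [hne a] at ha
    have hYj : stabRank (Y j) < k := by
      by_contra! hge
      obtain ⟨a, ha⟩ := exists_mem_colorSigns (c := c) hY hge
      simp [← hcolor, hne a] at ha
    have := hr j (Finset.mem_univ j)
    omega

theorem IsProperCol.le (hp : p.Prime) (hk : 1 ≤ k) (hc : IsProperCol p n k 2 t c) :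
    n ≤ p * (k - 1) + t * (p - 1) := by
  have : Fact p.Prime := ⟨hp⟩
  have : Fact (1 < p) := ⟨hp.one_lt⟩
  have : Nonempty (Fin t) := ⟨c ∅⟩
  rcases eq_or_ne n 0 with rfl | hn
  · exact Nat.zero_le _
  obtain ⟨l, ⟨hlen, hsort, hmem⟩, hchain⟩ :=
    (coneFiltration_signedSets p).exists_isFlag_isChain_ne (σ := colorSign n k c)
      (fun i X hX => colorSign_signShift hc hX) hn
  have hlt : (l.map (colorLevel n k c)).IsChain (· < ·) := by
    rw [List.isChain_map] at hchain ⊢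
    rw [List.isChain_iff_forall_rel_of_append_cons_cons] at hchain ⊢
    rintro X Y l₁ l₂ rfl
    have hXY : X ≤ Y := by
      rw [List.pairwise_append, List.pairwise_cons] at hsort
      exact hsort.2.1.1 Y (by simp)
    refine lt_of_le_of_ne (colorLevel_mono hXY) fun heq => hchain rfl ?_
    exact colorSign_eq_of_colorLevel_eq hk (hmem X (by simp)) (hmem Y (by simp)) hXY heq
  have hnodup : (l.map (colorLevel n k c)).Nodup :=
    (List.isChain_iff_pairwise.mp hlt).imp fun h => h.ne
  have hsub : (l.map (colorLevel n k c)).toFinset ⊆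
      Finset.Icc 1 (p * (k - 1) + t * (p - 1)) := by
    intro x hx
    simp only [List.mem_toFinset, List.mem_map] at hx
    obtain ⟨X, hX, rfl⟩ := hx
    exact Finset.mem_Icc.mpr ⟨colorLevel_pos (hmem X hX), colorLevel_le hc (hmem X hX)⟩
  have := Finset.card_le_card hsub
  rwa [List.toFinset_card_of_nodup hnodup, List.length_map, hlen, Nat.card_Icc,
    Nat.add_sub_cancel] at this

end SignedSets

theorem exists_isProperCol {p n k t : ℕ} (hp : 2 ≤ p) (hk : 1 ≤ k) (ht : 1 ≤ t)
    (h : n + p ≤ p * k + t * (p - 1)) : ∃ c : Finset ℕ → Fin t, IsProperCol p n k 2 t c := by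
  have hinf : ∀ S ∈ V n k 2, sInf (S : Set ℕ) ∈ S := fun S hS => by
    have : S.Nonempty := Finset.card_pos.mp (hS.2.1 ▸ hk)
    exact Nat.sInf_mem (s := (S : Set ℕ)) this
  refine ⟨fun S => ⟨min ((sInf (S : Set ℕ) - 1) / (p - 1)) (t - 1), by omega⟩, ?_⟩
  intro f hf hdisj
  by_contra! hcon
  simp only [Fin.mk.injEq] at hcon
  have hpos : 0 < p - 1 := by omega
  have hinj : Function.Injective fun i => sInf (f i : Set ℕ) := by
    intro i j hij
    by_contra hne
    exact Finset.disjoint_left.mp (hdisj i j hne) (hinf _ (hf i))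
      ((show sInf (f i : Set ℕ) = _ from hij) ▸ hinf _ (hf j))
  have hone : ∀ i, 1 ≤ sInf (f i : Set ℕ) := fun i =>
    (Finset.mem_Icc.mp ((hf i).1 (hinf _ (hf i)))).1
  let i₀ : Fin p := ⟨0, by omega⟩
  set q := (sInf (f i₀ : Set ℕ) - 1) / (p - 1) with hq
  rcases Nat.lt_or_ge q (t - 1) with hlt | hge
  · have hsub : Finset.univ.image (fun i => sInf (f i : Set ℕ)) ⊆
        Finset.Ico (q * (p - 1) + 1) (q * (p - 1) + 1 + (p - 1)) := by
      intro x hx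
      obtain ⟨i, -, rfl⟩ := Finset.mem_image.mp hx
      have hi := hcon i i₀
      have hqi : (sInf (f i : Set ℕ) - 1) / (p - 1) = q := by omega
      have h1 := Nat.div_mul_le_self (sInf (f i : Set ℕ) - 1) (p - 1)
      have h2 := Nat.lt_div_mul_add hpos (a := sInf (f i : Set ℕ) - 1)
      rw [hqi] at h1 h2
      have h3 := hone i
      simp only [Finset.mem_Ico]
      omega
    have := Finset.card_le_card hsub
    rw [Finset.card_image_of_injective _ hinj, Finset.card_univ, Fintype.card_fin,
      Nat.card_Ico] at this
    omega
  · have hsub : Finset.univ.biUnion f ⊆ Finset.Icc ((t - 1) * (p - 1) + 1) n := by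
      intro x hx
      obtain ⟨i, -, hxi⟩ := Finset.mem_biUnion.mp hx
      have hi := hcon i i₀
      have hqi : t - 1 ≤ (sInf (f i : Set ℕ) - 1) / (p - 1) := by omega
      have h1 := (Nat.mul_le_mul_right (p - 1) hqi).trans
        (Nat.div_mul_le_self (sInf (f i : Set ℕ) - 1) (p - 1))
      have h2 : sInf (f i : Set ℕ) ≤ x := Nat.sInf_le hxi
      have h3 := hone i
      exact Finset.mem_Icc.mpr ⟨by omega, (Finset.mem_Icc.mp ((hf i).1 hxi)).2⟩
    have hcard := Finset.card_le_card hsub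
    rw [Finset.card_biUnion fun i _ j _ hij => hdisj i j hij,
      Finset.sum_congr rfl fun i _ => (hf i).2.1, Finset.sum_const, Finset.card_univ,
      Fintype.card_fin, smul_eq_mul, Nat.card_Icc] at hcard
    obtain ⟨s, rfl⟩ := Nat.exists_eq_add_of_le' ht
    rw [Nat.add_sub_cancel] at hcard
    rw [add_mul, one_mul] at h
    have : 1 ≤ p * k := Nat.mul_pos (by omega) hk
    omega

theorem toNat_ceil_le_iff {p n k t : ℕ} (hp : 2 ≤ p) (hk : 1 ≤ k) :
    ⌈((n : ℚ) - ((k : ℚ) - 1) * p) / ((p : ℚ) - 1)⌉.toNat ≤ t ↔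
      n ≤ p * (k - 1) + t * (p - 1) := by
  have hpos : (0 : ℚ) < (p : ℚ) - 1 := by
    have : (2 : ℚ) ≤ p := by exact_mod_cast hp
    linarith
  rw [Int.toNat_le, Int.ceil_le, div_le_iff₀ hpos, ← Nat.cast_le (α := ℚ)]
  push_cast [Nat.cast_sub hk, Nat.cast_sub (one_le_two.trans hp)]
  constructor <;> intro h <;> linarith

/-- For `p` prime and `n ≥ pk`, the chromatic number of `KG^p([n] choose k)~_{2-stab}`
equals `⌈(n-(k-1)p)/(p-1)⌉`: this number of colors both suffices and is least. -/
theorem stmt_9 (p n k : ℕ) (hp : p.Prime) (hk : 1 ≤ k) (hn : p * k ≤ n) :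
    IsLeast {t : ℕ | ∃ c : Finset ℕ → Fin t, IsProperCol p n k 2 t c}
      (⌈((n : ℚ) - ((k : ℚ) - 1) * p) / ((p : ℚ) - 1)⌉.toNat) := by
  have hmul : p * k = p * (k - 1) + p := by
    rw [← Nat.mul_succ, Nat.succ_eq_add_one, Nat.sub_add_cancel hk]
  refine ⟨?_, fun t ⟨c, hc⟩ => (toNat_ceil_le_iff hp.two_le hk).mpr (hc.le hp hk)⟩
  have hle := (toNat_ceil_le_iff (n := n) (t := _) hp.two_le hk).mp le_rfl
  refine exists_isProperCol hp.two_le hk ?_ (by omega)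
  by_contra! h0
  rw [Nat.lt_one_iff.mp h0, zero_mul] at hle
  have := hp.pos
  omega
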